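/- In the exact-data case δ = 0, there exists x̃ ∈ B_{2ρ}(x₀) with F(x̃) = y such that the sequence (x_k⁰) converges weakly to x̃, i.e. ⟨x_k⁰, h⟩ → ⟨x̃, h⟩ for every h ∈ X. -/

import Mathlib

open Metric Filter
open scoped RealInnerProductSpace Topology

theorem summable_and_tendsto_of_add_le {a c e : ℕ → ℝ} (ha : ∀ k, 0 ≤ a k)
    (hc : ∀ k, 0 ≤ c k) (he : ∀ k, 0 ≤ e k) (hes : Summable e)
    (h : ∀ k, a (k + 1) + c k ≤ a k + e k) :
    Summable c ∧ ∃ l, Tendsto a atTop (𝓝 l) := by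
  have hsum : ∀ n, a n + ∑ i ∈ Finset.range n, c i ≤ a 0 + ∑ i ∈ Finset.range n, e i := by
    intro n
    induction n with
    | zero => simp
    | succ n ih =>
      rw [Finset.sum_range_succ, Finset.sum_range_succ]
      linarith [h n]
  have hele : ∀ n, ∑ i ∈ Finset.range n, e i ≤ ∑' i, e i := fun n =>
    hes.sum_le_tsum _ fun i _ => he i
  refine ⟨summable_of_sum_range_le (c := a 0 + ∑' i, e i) hc fun n => ?_, ?_⟩
  · linarith [hsum n, hele n, ha n]
  have hanti : Antitone fun n => a n - ∑ i ∈ Finset.range n, e i := by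
    refine antitone_nat_of_succ_le fun n => ?_
    rw [Finset.sum_range_succ]
    linarith [h n, hc n]
  have hbdd : BddBelow (Set.range fun n => a n - ∑ i ∈ Finset.range n, e i) := by
    refine ⟨-∑' i, e i, ?_⟩
    rintro _ ⟨n, rfl⟩
    dsimp only
    linarith [ha n, hele n]
  have hlim := (tendsto_atTop_ciInf hanti hbdd).add hes.hasSum.tendsto_sum_nat
  exact ⟨_, hlim.congr fun n => by ring⟩

theorem eq_zero_of_tendsto_of_summable_div {a : ℕ → ℝ} {l : ℝ} (ha : ∀ k, 0 ≤ a k)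
    (hl : Tendsto a atTop (𝓝 l)) (hs : Summable fun k : ℕ => a k / ((k : ℝ) + 1)) : l = 0 := by
  by_contra hne
  have hl0 : 0 < l := lt_of_le_of_ne (ge_of_tendsto' hl ha) (Ne.symm hne)
  obtain ⟨N, hN⟩ := eventually_atTop.1 (hl.eventually_const_lt (half_lt_self hl0))
  have h1 : Summable fun k : ℕ => (1 : ℝ) / ((k + N + 1 : ℕ) : ℝ) := by
    refine Summable.of_nonneg_of_le (fun k => by positivity) (fun k => ?_)
      (((summable_nat_add_iff N).2 hs).mul_left (2 / l))
    have := hN (k + N) (by omega)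
    push_cast
    rw [← mul_div_assoc]
    gcongr
    rw [div_mul_eq_mul_div, le_div_iff₀ hl0]
    linarith
  exact Real.not_summable_one_div_natCast
    ((summable_nat_add_iff (f := fun k : ℕ => (1 : ℝ) / (k : ℝ)) (N + 1)).1 h1)

section Hilbert

variable {X : Type*} [NormedAddCommGroup X] [InnerProductSpace ℝ X]

theorem Ultrafilter.exists_weak_limit_mem_closedBall [CompleteSpace X] {ι : Type*}
    (l : Ultrafilter ι) {x : ι → X} {c : X} {r : ℝ} (hx : ∀ i, x i ∈ closedBall c r) :
    ∃ u ∈ closedBall c r, ∀ h : X, Tendsto (fun i => ⟪x i, h⟫) l (𝓝 ⟪u, h⟫) := by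
  let T := InnerProductSpace.toDual ℝ X
  let f : ι → WeakDual ℝ X := fun i => StrongDual.toWeakDual (T (x i))
  obtain ⟨w, hw, hlw⟩ := isCompact_iff_ultrafilter_le_nhds.1
    (WeakDual.isCompact_closedBall (T c) r) (l.map f) (by
      rw [le_principal_iff]
      refine Filter.mem_map.2 (Filter.univ_mem' fun i => ?_)
      change dist (T (x i)) (T c) ≤ r
      rw [T.isometry.dist_eq]
      exact hx i)
  have hTw : T (T.symm (WeakDual.toStrongDual w)) = WeakDual.toStrongDual w :=
    T.apply_symm_apply _
  refine ⟨T.symm (WeakDual.toStrongDual w), ?_, fun h => ?_⟩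
  · rw [mem_closedBall, ← T.isometry.dist_eq, hTw]
    exact hw
  · rw [InnerProductSpace.toDual_symm_apply]
    exact ((WeakDual.eval_continuous h).tendsto w).comp hlw

/-- Opial's lemma, with cluster points taken along ultrafilters. -/
theorem exists_weak_limit_of_forall_tendsto_norm_sub [CompleteSpace X] {x : ℕ → X} {c : X} {r : ℝ}
    (hx : ∀ k, x k ∈ closedBall c r) {S : Set X}
    (hS : ∀ l : Ultrafilter ℕ, (l : Filter ℕ) ≤ atTop → ∀ u ∈ closedBall c r,
      (∀ h : X, Tendsto (fun k => ⟪x k, h⟫) l (𝓝 ⟪u, h⟫)) → u ∈ S)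
    (hlim : ∀ p ∈ S, ∃ a, Tendsto (fun k => ‖x k - p‖ ^ 2) atTop (𝓝 a)) :
    ∃ u ∈ S, ∀ h : X, Tendsto (fun k => ⟪x k, h⟫) atTop (𝓝 ⟪u, h⟫) := by
  have huniq : ∀ p ∈ S, ∀ q ∈ S, ∀ l m : Ultrafilter ℕ, (l : Filter ℕ) ≤ atTop →
      (m : Filter ℕ) ≤ atTop → (∀ h : X, Tendsto (fun k => ⟪x k, h⟫) l (𝓝 ⟪p, h⟫)) →
      (∀ h : X, Tendsto (fun k => ⟪x k, h⟫) m (𝓝 ⟪q, h⟫)) → p = q := by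
    intro p hp q hq l m hl hm hlp hmq
    obtain ⟨a, ha⟩ := hlim p hp
    obtain ⟨b, hb⟩ := hlim q hq
    have hab : Tendsto (fun k => ⟪x k, p - q⟫) atTop
        (𝓝 ((b - a + ‖p‖ ^ 2 - ‖q‖ ^ 2) / 2)) := by
      refine ((((hb.sub ha).add_const _).sub_const _).div_const 2).congr fun k => ?_
      rw [norm_sub_sq_real, norm_sub_sq_real, inner_sub_right]
      ring
    have h1 := tendsto_nhds_unique (hlp (p - q)) (hab.mono_left hl)
    have h2 := tendsto_nhds_unique (hmq (p - q)) (hab.mono_left hm)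
    rw [← sub_eq_zero, ← inner_self_eq_zero (𝕜 := ℝ), inner_sub_left, h1, h2, sub_self]
  let l₀ : Ultrafilter ℕ := Ultrafilter.of atTop
  have hl₀ : (l₀ : Filter ℕ) ≤ atTop := Ultrafilter.of_le _
  obtain ⟨u, hu, hul⟩ := l₀.exists_weak_limit_mem_closedBall hx
  have huS := hS l₀ hl₀ u hu hul
  refine ⟨u, huS, fun h => (Filter.tendsto_iff_ultrafilter _ _ _).2 fun m hm => ?_⟩
  obtain ⟨v, hv, hvm⟩ := m.exists_weak_limit_mem_closedBall hx
  rw [huniq u huS v (hS m hm v hv hvm) l₀ m hl₀ hm hul hvm]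
  exact hvm h

theorem ConvexOn.add_inner_gradient_le [CompleteSpace X] {s : Set X} {f : X → ℝ} {g u v : X}
    (hf : ConvexOn ℝ s f) (hu : u ∈ s) (hv : v ∈ s) (hg : HasGradientAt f g u) :
    f u + ⟪g, v - u⟫ ≤ f v := by
  have hconv : ConvexOn ℝ (Set.Icc (0 : ℝ) 1) (f ∘ AffineMap.lineMap (k := ℝ) u v) := by
    refine (hf.comp_affineMap (AffineMap.lineMap (k := ℝ) u v)).subset (fun t ht => ?_)
      (convex_Icc 0 1)
    exact hf.1.lineMap_mem hu hv ht
  have hder : HasDerivAt (f ∘ AffineMap.lineMap (k := ℝ) u v) ⟪g, v - u⟫ 0 := by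
    have hg' : HasFDerivAt f (InnerProductSpace.toDual ℝ X g)
        (AffineMap.lineMap (k := ℝ) u v (0 : ℝ)) := by
      rw [AffineMap.lineMap_apply_zero]
      exact hg.hasFDerivAt
    exact hg'.comp_hasDerivAt 0 AffineMap.hasDerivAt_lineMap
  have := hconv.le_slope_of_hasDerivAt (by simp) (by simp) zero_lt_one hder
  simp [slope_def_field] at this
  linarith

theorem le_add_inner_gradient_add_sq [CompleteSpace X] {s : Set X} (hs : Convex ℝ s) {f : X → ℝ}
    {g : X → X} (hg : ∀ u ∈ s, HasGradientAt f (g u) u) {L : ℝ}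
    (hL : ∀ u ∈ s, ∀ v ∈ s, ‖g u - g v‖ ≤ L * ‖u - v‖) {u v : X} (hu : u ∈ s) (hv : v ∈ s) :
    f v ≤ f u + ⟪g u, v - u⟫ + L / 2 * ‖v - u‖ ^ 2 := by
  let φ : ℝ → ℝ := fun t =>
    f (AffineMap.lineMap u v t) - t * ⟪g u, v - u⟫ - L / 2 * ‖v - u‖ ^ 2 * t ^ 2
  have hmem : ∀ t ∈ Set.Icc (0 : ℝ) 1, AffineMap.lineMap (k := ℝ) u v t ∈ s := fun t ht =>
    hs.lineMap_mem hu hv ht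
  have hder : ∀ t ∈ Set.Icc (0 : ℝ) 1, HasDerivAt φ
      (⟪g (AffineMap.lineMap u v t), v - u⟫ - ⟪g u, v - u⟫ - L * ‖v - u‖ ^ 2 * t) t := by
    intro t ht
    have h1 : HasDerivAt (f ∘ AffineMap.lineMap (k := ℝ) u v)
        ⟪g (AffineMap.lineMap u v t), v - u⟫ t :=
      (hg _ (hmem t ht)).hasFDerivAt.comp_hasDerivAt t AffineMap.hasDerivAt_lineMap
    have h2 := (hasDerivAt_id t).mul_const ⟪g u, v - u⟫
    have h3 := (hasDerivAt_pow 2 t).const_mul (L / 2 * ‖v - u‖ ^ 2)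
    refine ((h1.sub h2).sub h3).congr_deriv ?_
    push_cast
    ring
  have hanti : AntitoneOn φ (Set.Icc 0 1) := by
    refine antitoneOn_of_hasDerivWithinAt_nonpos (convex_Icc 0 1)
      (fun t ht => (hder t ht).continuousAt.continuousWithinAt)
      (fun t ht => (hder t (interior_subset ht)).hasDerivWithinAt) fun t ht => ?_
    replace ht := interior_subset ht
    have hsub : AffineMap.lineMap u v t - u = t • (v - u) := by
      simp [AffineMap.lineMap_apply]
    have hle := hL _ (hmem t ht) u hu
    rw [hsub, norm_smul, Real.norm_of_nonneg ht.1] at hle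
    have hin := real_inner_le_norm (g (AffineMap.lineMap u v t) - g u) (v - u)
    rw [inner_sub_left] at hin
    nlinarith [mul_le_mul_of_nonneg_right hle (norm_nonneg (v - u))]
  have h01 := hanti (Set.left_mem_Icc.2 zero_le_one) (Set.right_mem_Icc.2 zero_le_one) zero_le_one
  simp [φ] at h01
  linarith

theorem inner_sub_proj_le_zero {C : Set X} (hC : Convex ℝ C) {w q : X} (hq : q ∈ C)
    (hmin : ∀ v ∈ C, ‖w - q‖ ≤ ‖w - v‖) : ∀ v ∈ C, ⟪w - q, v - q⟫ ≤ 0 := by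
  refine (norm_eq_iInf_iff_real_inner_le_zero hC hq).1 (le_antisymm ?_ ?_)
  · have : Nonempty C := ⟨⟨q, hq⟩⟩
    exact le_ciInf fun v => hmin v v.2
  · exact ciInf_le ⟨0, by rintro _ ⟨v, rfl⟩; exact norm_nonneg _⟩ (⟨q, hq⟩ : C)

/-- The basic inequality for one projected gradient step. -/
theorem projected_gradient_step_le [CompleteSpace X] {s C : Set X} (hCs : C ⊆ s)
    (hC : Convex ℝ C) {f : X → ℝ} (hf : ConvexOn ℝ s f) {g : X → X}
    (hg : ∀ u ∈ s, HasGradientAt f (g u) u) {L ω : ℝ}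
    (hL : ∀ u ∈ s, ∀ v ∈ s, ‖g u - g v‖ ≤ L * ‖u - v‖) (hω : 0 < ω) (hωL : ω * L ≤ 1)
    {z q v : X} (hz : z ∈ s) (hq : q ∈ C) (hv : v ∈ C)
    (hmin : ∀ v ∈ C, ‖z - ω • g z - q‖ ≤ ‖z - ω • g z - v‖) :
    2 * ω * f q - 2 * ω * f v ≤ ‖z - v‖ ^ 2 - ‖q - v‖ ^ 2 := by
  have h1 := inner_sub_proj_le_zero hC hq hmin v hv
  have h2 := hf.add_inner_gradient_le hz (hCs hv) (hg z hz)
  have h3 := le_add_inner_gradient_add_sq hf.1 hg hL hz (hCs hq)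
  have h4 : ‖z - v‖ ^ 2 = ‖z - q‖ ^ 2 + 2 * ⟪z - q, q - v⟫ + ‖q - v‖ ^ 2 := by
    rw [← norm_add_sq_real, sub_add_sub_cancel]
  have h5 : ⟪z - ω • g z - q, v - q⟫ = -⟪z - q, q - v⟫ - ω * ⟪g z, v - z⟫ + ω * ⟪g z, q - z⟫ := by
    simp only [inner_sub_left, inner_sub_right, real_inner_smul_left]
    ring
  rw [norm_sub_rev q z] at h3
  nlinarith [mul_le_mul_of_nonneg_left h2 hω.le, mul_le_mul_of_nonneg_left h3 hω.le,
    mul_le_mul_of_nonneg_right hωL (sq_nonneg ‖z - q‖)]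

section Inertial

variable {C : Set X} {W : X → ℝ} {b : ℝ} {x z : ℕ → X}

theorem lyapunov_step_le (hW : ConvexOn ℝ C W) (hb : 0 < b) (hx : ∀ k, x k ∈ C)
    (hz : ∀ k : ℕ, z k = x k + (((k : ℝ) - 1) / ((k : ℝ) + b)) • (x k - x (k - 1)))
    (hstep : ∀ k, ∀ v ∈ C, W (x (k + 1)) - W v ≤ ‖z k - v‖ ^ 2 - ‖x (k + 1) - v‖ ^ 2)
    {p : X} (hp : p ∈ C) (hWp : W p = 0) (k : ℕ) :
    ((k : ℝ) + b) ^ 2 * W (x (k + 1)) - k * (k + b) * W (x k) ≤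
      b ^ 2 * ‖x k - p + (((k : ℝ) - 1) / b) • (x k - x (k - 1))‖ ^ 2 -
        b ^ 2 * ‖x (k + 1) - p + ((k : ℝ) / b) • (x (k + 1) - x k)‖ ^ 2 := by
  have hkb : 0 < (k : ℝ) + b := by positivity
  have hsum : (k : ℝ) / (k + b) + b / (k + b) = 1 := by field_simp
  have hk0 : 0 ≤ (k : ℝ) / (k + b) := by positivity
  have hb0 : 0 ≤ b / ((k : ℝ) + b) := by positivity
  have hv := hW.1 (hx k) hp hk0 hb0 hsum
  have hWv := hW.2 (hx k) hp hk0 hb0 hsum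
  have h := hstep k _ hv
  have e1 : z k - (((k : ℝ) / (k + b)) • x k + (b / ((k : ℝ) + b)) • p) =
      (b / ((k : ℝ) + b)) • (x k - p + (((k : ℝ) - 1) / b) • (x k - x (k - 1))) := by
    rw [hz]
    match_scalars <;> field_simp <;> ring
  have e2 : x (k + 1) - (((k : ℝ) / (k + b)) • x k + (b / ((k : ℝ) + b)) • p) =
      (b / ((k : ℝ) + b)) • (x (k + 1) - p + ((k : ℝ) / b) • (x (k + 1) - x k)) := by
    match_scalars <;> field_simp <;> ring
  rw [e1, e2, norm_smul, norm_smul, Real.norm_of_nonneg hb0, mul_pow, mul_pow] at h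
  rw [hWp, smul_zero, add_zero, smul_eq_mul] at hWv
  have h' := mul_le_mul_of_nonneg_left (h.trans' (sub_le_sub_left hWv _)) (sq_nonneg ((k : ℝ) + b))
  have e3 : ((k : ℝ) + b) ^ 2 * (k / (k + b)) = k * (k + b) := by field_simp
  have e4 : ((k : ℝ) + b) ^ 2 * (b / (k + b)) ^ 2 = b ^ 2 := by field_simp
  rwa [mul_sub, mul_sub, ← mul_assoc, ← mul_assoc, ← mul_assoc, e3, e4] at h'

theorem summable_and_tendsto_lyapunov (hW : ConvexOn ℝ C W) (hW0 : ∀ u, 0 ≤ W u) (hb : 2 < b)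
    (hx : ∀ k, x k ∈ C)
    (hz : ∀ k : ℕ, z k = x k + (((k : ℝ) - 1) / ((k : ℝ) + b)) • (x k - x (k - 1)))
    (hstep : ∀ k, ∀ v ∈ C, W (x (k + 1)) - W v ≤ ‖z k - v‖ ^ 2 - ‖x (k + 1) - v‖ ^ 2)
    {p : X} (hp : p ∈ C) (hWp : W p = 0) :
    (Summable fun k : ℕ => ((k : ℝ) + 1) * W (x k)) ∧
      ∃ a, Tendsto (fun k : ℕ => ((k : ℝ) - 1 + b) ^ 2 * W (x k) +
        b ^ 2 * ‖x k - p + (((k : ℝ) - 1) / b) • (x k - x (k - 1))‖ ^ 2) atTop (𝓝 a) := by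
  have hb2 : 0 < b - 2 := sub_pos.2 hb
  have key := summable_and_tendsto_of_add_le
    (a := fun k : ℕ => ((k : ℝ) - 1 + b) ^ 2 * W (x k) +
      b ^ 2 * ‖x k - p + (((k : ℝ) - 1) / b) • (x k - x (k - 1))‖ ^ 2)
    (c := fun k : ℕ => (b - 2) * (((k : ℝ) + 1) * W (x k))) (e := fun _ => 0)
    (fun k => by have := hW0 (x k); positivity) (fun k => by have := hW0 (x k); positivity)
    (fun _ => le_rfl) summable_zero fun k => by
      have h := lyapunov_step_le hW (by linarith) hx hz hstep hp hWp k
      have hnn : 0 ≤ (b ^ 2 - 3 * b + 3) * W (x k) :=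
        mul_nonneg (by nlinarith [sq_nonneg (b - 3 / 2)]) (hW0 _)
      simp only [Nat.cast_add, Nat.cast_one, add_sub_cancel_right, Nat.add_sub_cancel]
      linarith
  exact ⟨(summable_mul_left_iff hb2.ne').1 key.1, key.2⟩

theorem tendsto_sq_mul_energy (hW0 : ∀ u, 0 ≤ W u) (hb : 2 < b) (hx : ∀ k, x k ∈ C)
    (hz : ∀ k : ℕ, z k = x k + (((k : ℝ) - 1) / ((k : ℝ) + b)) • (x k - x (k - 1)))
    (hstep : ∀ k, ∀ v ∈ C, W (x (k + 1)) - W v ≤ ‖z k - v‖ ^ 2 - ‖x (k + 1) - v‖ ^ 2)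
    (hsW : Summable fun k : ℕ => ((k : ℝ) + 1) * W (x k)) :
    Tendsto (fun k : ℕ => ((k : ℝ) - 1 + b) ^ 2 * (W (x k) + ‖x k - x (k - 1)‖ ^ 2))
      atTop (𝓝 0) := by
  have hb2 : 0 < b - 2 := sub_pos.2 hb
  have ha : ∀ k : ℕ, 0 ≤ ((k : ℝ) - 1 + b) ^ 2 * (W (x k) + ‖x k - x (k - 1)‖ ^ 2) := fun k => by
    have := hW0 (x k)
    positivity
  obtain ⟨hsD, a, hlim⟩ := summable_and_tendsto_of_add_le ha
    (c := fun k : ℕ => (b - 2) * (((k : ℝ) + 1) * ‖x k - x (k - 1)‖ ^ 2))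
    (e := fun k : ℕ => 2 * b * (((k : ℝ) + 1) * W (x k)))
    (fun k => by positivity) (fun k => by have := hW0 (x k); positivity)
    (hsW.mul_left _) fun k => by
      have hkb : 0 < (k : ℝ) + b := by positivity
      have h := hstep k (x k) (hx k)
      rw [hz, add_sub_cancel_left, norm_smul, mul_pow, Real.norm_eq_abs, sq_abs] at h
      have h' := mul_le_mul_of_nonneg_left h (sq_nonneg ((k : ℝ) + b))
      rw [mul_sub, mul_sub, ← mul_assoc, ← mul_pow, mul_div_cancel₀ _ hkb.ne'] at h'
      have hk : (0 : ℝ) ≤ k := k.cast_nonneg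
      have hD : 0 ≤ (b * (2 * k - 2 + b) - (b - 2) * (k + 1)) * ‖x k - x (k - 1)‖ ^ 2 :=
        mul_nonneg (by nlinarith [mul_nonneg hk hb2.le, sq_nonneg (b - 2)]) (sq_nonneg _)
      have hE : 0 ≤ (2 * b * (k + 1) - (2 * k + 2 * b - 1)) * W (x k) :=
        mul_nonneg (by nlinarith [mul_nonneg hk hb2.le]) (hW0 _)
      simp only [Nat.cast_add, Nat.cast_one, add_sub_cancel_right, Nat.add_sub_cancel]
      linarith
  replace hsD := (summable_mul_left_iff hb2.ne').1 hsD
  suffices a = 0 by rwa [this] at hlim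
  refine eq_zero_of_tendsto_of_summable_div ha hlim ?_
  refine Summable.of_nonneg_of_le (fun k => div_nonneg (ha k) (by positivity)) (fun k => ?_)
    ((hsW.add hsD).mul_left (b ^ 2))
  have hk : (0 : ℝ) ≤ k := k.cast_nonneg
  have hW := hW0 (x k)
  rw [div_le_iff₀ (by positivity)]
  have hsq : ((k : ℝ) - 1 + b) ^ 2 ≤ (b * (k + 1)) ^ 2 :=
    pow_le_pow_left₀ (by linarith) (by nlinarith) 2
  calc _ ≤ (b * ((k : ℝ) + 1)) ^ 2 * (W (x k) + ‖x k - x (k - 1)‖ ^ 2) := by gcongr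
    _ = _ := by ring

theorem exists_tendsto_norm_sub_sq (hW : ConvexOn ℝ C W) (hW0 : ∀ u, 0 ≤ W u) (hb : 2 < b)
    (hx : ∀ k, x k ∈ C)
    (hz : ∀ k : ℕ, z k = x k + (((k : ℝ) - 1) / ((k : ℝ) + b)) • (x k - x (k - 1)))
    (hstep : ∀ k, ∀ v ∈ C, W (x (k + 1)) - W v ≤ ‖z k - v‖ ^ 2 - ‖x (k + 1) - v‖ ^ 2)
    {p : X} (hp : p ∈ C) (hWp : W p = 0) {R : ℝ} (hR : ∀ k, ‖x k - p‖ ≤ R) :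
    ∃ a, Tendsto (fun k => ‖x k - p‖ ^ 2) atTop (𝓝 a) := by
  have hb0 : 0 < b := by linarith
  obtain ⟨hsW, a, ha⟩ := summable_and_tendsto_lyapunov hW hW0 hb hx hz hstep hp hWp
  have h0 := tendsto_sq_mul_energy hW0 hb hx hz hstep hsW
  have hle : ∀ k : ℕ, ‖((k : ℝ) - 1) • (x k - x (k - 1))‖ ^ 2 ≤
      ((k : ℝ) - 1 + b) ^ 2 * (W (x k) + ‖x k - x (k - 1)‖ ^ 2) := fun k => by
    have hk : (0 : ℝ) ≤ k := k.cast_nonneg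
    rw [norm_smul, mul_pow, Real.norm_eq_abs, sq_abs]
    have : ((k : ℝ) - 1) ^ 2 ≤ ((k : ℝ) - 1 + b) ^ 2 := by nlinarith
    have hWk := hW0 (x k)
    gcongr
    linarith
  have hd2 : Tendsto (fun k : ℕ => ‖((k : ℝ) - 1) • (x k - x (k - 1))‖ ^ 2) atTop (𝓝 0) :=
    squeeze_zero (fun k => by positivity) hle h0
  have hd : Tendsto (fun k : ℕ => ‖((k : ℝ) - 1) • (x k - x (k - 1))‖) atTop (𝓝 0) := by
    simpa [Real.sqrt_sq] using hd2.sqrt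
  have hW2 : Tendsto (fun k : ℕ => ((k : ℝ) - 1 + b) ^ 2 * W (x k)) atTop (𝓝 0) :=
    squeeze_zero (fun k => by have := hW0 (x k); positivity)
      (fun k => by gcongr; exact le_add_of_nonneg_right (sq_nonneg _)) h0
  have hin : Tendsto (fun k : ℕ => ⟪x k - p, ((k : ℝ) - 1) • (x k - x (k - 1))⟫) atTop (𝓝 0) := by
    refine squeeze_zero_norm (fun k => ?_) (by simpa using hd.const_mul R)
    exact (norm_inner_le_norm _ _).trans (mul_le_mul_of_nonneg_right (hR k) (norm_nonneg _))
  have := (((ha.sub hW2).sub hd2).sub (hin.const_mul (2 * b))).div_const (b ^ 2)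
  refine ⟨_, this.congr fun k => ?_⟩
  have e : (((k : ℝ) - 1) / b) • (x k - x (k - 1)) =
      b⁻¹ • (((k : ℝ) - 1) • (x k - x (k - 1))) := by
    rw [smul_smul, div_eq_inv_mul]
  rw [e, norm_add_sq_real, real_inner_smul_right, norm_smul b⁻¹, Real.norm_of_nonneg (by positivity)]
  field_simp
  ring

end Inertial

theorem ConvexOn.nonpos_of_weak_tendsto [CompleteSpace X] {s : Set X} {f : X → ℝ} {g u : X}
    (hf : ConvexOn ℝ s f) (hu : u ∈ s) (hg : HasGradientAt f g u) {ι : Type*} {l : Filter ι}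
    [l.NeBot] {x : ι → X} (hx : ∀ i, x i ∈ s)
    (hxu : ∀ h : X, Tendsto (fun i => ⟪x i, h⟫) l (𝓝 ⟪u, h⟫))
    (hfx : Tendsto (fun i => f (x i)) l (𝓝 0)) : f u ≤ 0 := by
  have h1 : Tendsto (fun i => f u + ⟪g, x i - u⟫) l (𝓝 (f u)) := by
    have := ((hxu g).sub_const ⟪u, g⟫).const_add (f u)
    rw [sub_self, add_zero] at this
    refine this.congr fun i => ?_
    rw [inner_sub_right, real_inner_comm g, real_inner_comm g]
  exact le_of_tendsto_of_tendsto' h1 hfx fun i => hf.add_inner_gradient_le hu (hx i) hg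

end Hilbert

theorem hasGradientAt_half_norm_sub_sq {X Y : Type*} [NormedAddCommGroup X]
    [InnerProductSpace ℝ X] [CompleteSpace X] [NormedAddCommGroup Y] [InnerProductSpace ℝ Y]
    [CompleteSpace Y] {F : X → Y} {A : X →L[ℝ] Y} {u : X} (y : Y) (hF : HasFDerivAt F A u) :
    HasGradientAt (fun u => (1 / 2) * ‖F u - y‖ ^ 2)
      (ContinuousLinearMap.adjoint A (F u - y)) u := by
  rw [hasGradientAt_iff_hasFDerivAt]
  refine (((hF.sub_const y).norm_sq).const_mul (1 / 2)).congr_fderiv ?_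
  ext h
  simp [ContinuousLinearMap.adjoint_inner_left]

/-- In the exact-data case, there exists `x̃ ∈ B_{2ρ}(x₀)` with `F(x̃) = y`
such that the exact-data Nesterov iterates `x_k⁰` converge weakly to `x̃`. -/
theorem nesterov_exact_weak_convergence
    {X Y : Type*} [NormedAddCommGroup X] [InnerProductSpace ℝ X] [CompleteSpace X]
    [NormedAddCommGroup Y] [InnerProductSpace ℝ Y] [CompleteSpace Y]
    (x₀ : X) (ρ : ℝ) (hρ : 0 < ρ)
    (F : X → Y) (F' : X → X →L[ℝ] Y)
    (hF : ∀ u ∈ closedBall x₀ (6 * ρ), HasFDerivAt F (F' u) u)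
    (ωb : ℝ) (hωb : ∀ u ∈ closedBall x₀ (6 * ρ), ‖F' u‖ ≤ ωb)
    -- weak sequential closedness of `F` on `B_{2ρ}(x₀)`
    (hwsc : ∀ (u : ℕ → X) (u' : X) (v : Y),
      (∀ n, u n ∈ closedBall x₀ (2 * ρ)) →
      (∀ h : X, Tendsto (fun n => ⟪u n, h⟫) atTop (nhds ⟪u', h⟫)) →
      Tendsto (fun n => F (u n)) atTop (nhds v) →
      u' ∈ closedBall x₀ (2 * ρ) ∧ F u' = v)
    (y : Y) (xstar : X) (hxstar : xstar ∈ closedBall x₀ ρ) (hFxstar : F xstar = y)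
    (Φ0 : X → ℝ)
    (hΦ0 : ∀ u, Φ0 u = (1 / 2) * ‖F u - y‖ ^ 2)
    (hconv : ConvexOn ℝ (closedBall x₀ (6 * ρ)) Φ0)
    (L : ℝ) (hL : 0 < L)
    (hLip : ∀ u ∈ closedBall x₀ (6 * ρ), ∀ v ∈ closedBall x₀ (6 * ρ),
      ‖(ContinuousLinearMap.adjoint (F' u)) (F u - y) -
        (ContinuousLinearMap.adjoint (F' v)) (F v - y)‖ ≤ L * ‖u - v‖)
    (α ω : ℝ) (hα : 3 < α) (hω : 0 < ω) (hωL : ω < 1 / L)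
    (P : X → X)
    (hP_mem : ∀ u, P u ∈ closedBall x₀ (2 * ρ))
    (hP_proj : ∀ u, ∀ v ∈ closedBall x₀ (2 * ρ), ‖u - P u‖ ≤ ‖u - v‖)
    (x z : ℕ → X)
    (hx0 : x 0 = x₀)
    (hz : ∀ k : ℕ, z k = x k + (((k : ℝ) - 1) / ((k : ℝ) + α - 1)) • (x k - x (k - 1)))
    (hx : ∀ k : ℕ, x (k + 1) = P (z k + ω • (ContinuousLinearMap.adjoint (F' (z k))) (y - F (z k)))) :
    ∃ xt : X, xt ∈ closedBall x₀ (2 * ρ) ∧ F xt = y ∧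
      ∀ h : X, Tendsto (fun k => ⟪x k, h⟫) atTop (nhds ⟪xt, h⟫) := by
  obtain rfl : Φ0 = fun u => (1 / 2) * ‖F u - y‖ ^ 2 := funext hΦ0
  have hC : Convex ℝ (closedBall x₀ (2 * ρ)) := convex_closedBall _ _
  have hCs : closedBall x₀ (2 * ρ) ⊆ closedBall x₀ (6 * ρ) :=
    closedBall_subset_closedBall (by linarith)
  have hgrad := fun u hu => hasGradientAt_half_norm_sub_sq y (hF u hu)
  have hxC : ∀ k, x k ∈ closedBall x₀ (2 * ρ) := by
    rintro (_ | k)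
    · rw [hx0]
      exact mem_closedBall_self (by positivity)
    · rw [hx]
      exact hP_mem _
  have hzs : ∀ k, z k ∈ closedBall x₀ (6 * ρ) := by
    rintro (_ | k)
    · simpa [hz, hx0] using hρ.le
    · have hcoef : |(((k + 1 : ℕ) : ℝ) - 1) / (((k + 1 : ℕ) : ℝ) + α - 1)| ≤ 1 := by
        have hk : (0 : ℝ) ≤ k := k.cast_nonneg
        push_cast
        rw [abs_of_nonneg (div_nonneg (by linarith) (by linarith)), div_le_one (by linarith)]
        linarith
      have h1 := mem_closedBall_iff_norm.1 (hxC (k + 1))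
      have h2 := mem_closedBall_iff_norm.1 (hxC k)
      have h3 : ‖x (k + 1) - x k‖ ≤ 4 * ρ := by
        have := norm_sub_le (x (k + 1) - x₀) (x k - x₀)
        rw [sub_sub_sub_cancel_right] at this
        linarith
      rw [mem_closedBall_iff_norm, hz, add_sub_right_comm, Nat.add_sub_cancel]
      refine (norm_add_le _ _).trans ?_
      rw [norm_smul, Real.norm_eq_abs]
      linarith [mul_le_of_le_one_left (norm_nonneg (x (k + 1) - x k)) hcoef]
  have hωL' : ω * L ≤ 1 := ((lt_div_iff₀ hL).1 hωL).le
  let W : X → ℝ := fun u => 2 * ω * ((1 / 2) * ‖F u - y‖ ^ 2)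
  have hW : ConvexOn ℝ (closedBall x₀ (2 * ρ)) W :=
    (hconv.subset hCs hC).smul (by positivity : 0 ≤ 2 * ω)
  have hW0 : ∀ u, 0 ≤ W u := fun u => by positivity
  have hWzero : ∀ u, F u = y → W u = 0 := fun u hu => by simp [W, hu]
  have hstep : ∀ k, ∀ v ∈ closedBall x₀ (2 * ρ),
      W (x (k + 1)) - W v ≤ ‖z k - v‖ ^ 2 - ‖x (k + 1) - v‖ ^ 2 := by
    intro k v hv
    refine projected_gradient_step_le hCs hC hconv hgrad hLip hω hωL' (hzs k) (hxC _) hv ?_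
    have hneg : z k + ω • (ContinuousLinearMap.adjoint (F' (z k))) (y - F (z k)) =
        z k - ω • (ContinuousLinearMap.adjoint (F' (z k))) (F (z k) - y) := by
      rw [← neg_sub (F (z k)) y, map_neg, smul_neg, ← sub_eq_add_neg]
    rw [hx, hneg]
    exact hP_proj _
  have hz' : ∀ k : ℕ,
      z k = x k + (((k : ℝ) - 1) / ((k : ℝ) + (α - 1))) • (x k - x (k - 1)) := fun k => by
    rw [hz, add_sub_assoc (k : ℝ)]
  have hb : 2 < α - 1 := by linarith
  obtain ⟨hsW, -⟩ := summable_and_tendsto_lyapunov hW hW0 hb hxC hz' hstep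
    (closedBall_subset_closedBall (by linarith) hxstar) (hWzero _ hFxstar)
  have hΦlim : Tendsto (fun k => (1 / 2) * ‖F (x k) - y‖ ^ 2) atTop (𝓝 0) := by
    have hWlim : Tendsto (fun k => W (x k)) atTop (𝓝 0) :=
      squeeze_zero (fun k => hW0 _)
        (fun k => le_mul_of_one_le_left (hW0 _) (by simp)) hsW.tendsto_atTop_zero
    have := hWlim.const_mul (2 * ω)⁻¹
    rw [mul_zero] at this
    exact this.congr fun k => inv_mul_cancel_left₀ (by positivity) _
  obtain ⟨u, hu, hlim⟩ := exists_weak_limit_of_forall_tendsto_norm_sub hxC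
    (S := {u | u ∈ closedBall x₀ (2 * ρ) ∧ F u = y}) (fun l hl u hu hlu => by
      have := hconv.nonpos_of_weak_tendsto (hCs hu) (hgrad u (hCs hu)) (fun k => hCs (hxC k)) hlu
        (hΦlim.mono_left hl)
      have h0 : ‖F u - y‖ ^ 2 = 0 := le_antisymm (by linarith) (sq_nonneg _)
      exact ⟨hu, sub_eq_zero.1 (norm_eq_zero.1 (pow_eq_zero_iff two_ne_zero |>.1 h0))⟩)
    (fun p hp => exists_tendsto_norm_sub_sq hW hW0 hb hxC hz' hstep hp.1 (hWzero p hp.2)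
      (R := 4 * ρ) fun k => by
        have h1 := mem_closedBall_iff_norm.1 (hxC k)
        have h2 := mem_closedBall_iff_norm.1 hp.1
        have := norm_sub_le (x k - x₀) (p - x₀)
        rw [sub_sub_sub_cancel_right] at this
        linarith)
  exact ⟨u, hu.1, hu.2, hlim⟩
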